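/- arXiv:1511.08489 — 6 statements merged into one kernel-verified Lean document; each statement's English description precedes it below -/
import Mathlib

section
/- For every integer n, the characteristic polynomial of the 6×6 matrix Â(n) is even in β and is given explicitly by det(β·I₆ − Â(n)) = β⁶ + a₂(n)β⁴ + a₁(n)β² + a₀(n) for all β ∈ ℂ, where a₂(n) = (αbdω² − 3)n² − (cα + γ), a₁(n) = (3 − 2αbdω²)n⁴ + (2(cα + γ) − αω²(b + d))n² + α, and a₀(n) = n²[(αbdω² − 1)n⁴ + (α(dω² − c) + γ(bcαω² − 1))n² + α(ω² − 1)]. -/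
open Matrix

/-- The `n`-th Fourier mode matrix `Â(n)` of the spatial-dynamics formulation of the
travelling-wave system for the 2D abcd-Boussinesq system, with `α = 1/(ac)`, `γ = 1/c`. -/
noncomputable def Ahat (a b c d ω : ℝ) (n : ℤ) : Matrix (Fin 6) (Fin 6) ℂ :=
  let α : ℂ := 1 / ((a : ℂ) * (c : ℂ))
  let γ : ℂ := 1 / (c : ℂ)
  let N : ℂ := (n : ℂ)
  !![0, Complex.I * N, 0, 0, 0, 0;
     0, 0, 1, 0, 0, 0;
     0, 0, 0, 1, 0, 0;
     -Complex.I * N * (α * d * ω ^ 2 - γ) - Complex.I * N ^ 3 * (α * b * d * ω ^ 2 - 1), 0,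
       γ - N ^ 2 * (α * b * d * ω ^ 2 - 2), 0, -Complex.I * N * ω * (γ - α * d), 0;
     0, 0, 0, 0, 0, 1;
     -(ω : ℂ) * c * α - N ^ 2 * b * ω * c * α, 0, Complex.I * N * b * ω * c * α, 0,
       (c : ℂ) * α + N ^ 2, 0]

/-- `a₂(n) = (αbdω² − 3)n² − (cα + γ)`. -/
noncomputable def a2C (a b c d ω : ℝ) (n : ℤ) : ℂ :=
  let α : ℂ := 1 / ((a : ℂ) * (c : ℂ))
  let γ : ℂ := 1 / (c : ℂ)
  (α * b * d * ω ^ 2 - 3) * (n : ℂ) ^ 2 - ((c : ℂ) * α + γ)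

/-- `a₁(n) = (3 − 2αbdω²)n⁴ + (2(cα + γ) − αω²(b + d))n² + α`. -/
noncomputable def a1C (a b c d ω : ℝ) (n : ℤ) : ℂ :=
  let α : ℂ := 1 / ((a : ℂ) * (c : ℂ))
  let γ : ℂ := 1 / (c : ℂ)
  (3 - 2 * α * b * d * ω ^ 2) * (n : ℂ) ^ 4 + (2 * ((c : ℂ) * α + γ) - α * ω ^ 2 * ((b : ℂ) + d)) * (n : ℂ) ^ 2 + α

/-- `a₀(n) = n²[(αbdω² − 1)n⁴ + (α(dω² − c) + γ(bcαω² − 1))n² + α(ω² − 1)]`. -/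
noncomputable def a0C (a b c d ω : ℝ) (n : ℤ) : ℂ :=
  let α : ℂ := 1 / ((a : ℂ) * (c : ℂ))
  let γ : ℂ := 1 / (c : ℂ)
  (n : ℂ) ^ 2 * ((α * b * d * ω ^ 2 - 1) * (n : ℂ) ^ 4 +
    (α * ((d : ℂ) * ω ^ 2 - c) + γ * ((b : ℂ) * c * α * ω ^ 2 - 1)) * (n : ℂ) ^ 2 +
    α * ((ω : ℂ) ^ 2 - 1))

/-- The characteristic polynomial of a `6 × 6` matrix with the sparsity pattern of `Â(n)`. -/
lemma det_smul_one_sub_sparse {R : Type*} [CommRing R] (p q r s u v w β : R) :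
    (β • (1 : Matrix (Fin 6) (Fin 6) R) -
      !![0, p, 0, 0, 0, 0;
         0, 0, 1, 0, 0, 0;
         0, 0, 0, 1, 0, 0;
         q, 0, r, 0, s, 0;
         0, 0, 0, 0, 0, 1;
         u, 0, v, 0, w, 0]).det =
      (β ^ 2 - w) * (β ^ 4 - r * β ^ 2 - p * q) - s * (p * u + v * β ^ 2) := by
  have h : β • (1 : Matrix (Fin 6) (Fin 6) R) -
      !![0, p, 0, 0, 0, 0;
         0, 0, 1, 0, 0, 0;
         0, 0, 0, 1, 0, 0;
         q, 0, r, 0, s, 0;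
         0, 0, 0, 0, 0, 1;
         u, 0, v, 0, w, 0] =
      !![β, -p, 0, 0, 0, 0;
         0, β, -1, 0, 0, 0;
         0, 0, β, -1, 0, 0;
         -q, 0, -r, β, -s, 0;
         0, 0, 0, 0, β, -1;
         -u, 0, -v, 0, -w, β] := by
    ext i j
    fin_cases i <;> fin_cases j <;> simp
  rw [h]
  simp [det_succ_row_zero, Fin.sum_univ_succ, Fin.succAbove]
  ring

/-- The characteristic polynomial of `Â(n)` is even in `β` and given explicitly by
`det(β·I₆ − Â(n)) = β⁶ + a₂(n)β⁴ + a₁(n)β² + a₀(n)`. -/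
theorem charpoly_Ahat (a b c d ω : ℝ) (ha : 0 < a) (hb : 0 < b) (hc : 0 < c) (hd : 0 < d)
    (n : ℤ) (β : ℂ) :
    (β • (1 : Matrix (Fin 6) (Fin 6) ℂ) - Ahat a b c d ω n).det =
      β ^ 6 + a2C a b c d ω n * β ^ 4 + a1C a b c d ω n * β ^ 2 + a0C a b c d ω n := by
  have ha' : (a : ℂ) ≠ 0 := by exact_mod_cast ha.ne'
  have hc' : (c : ℂ) ≠ 0 := by exact_mod_cast hc.ne'
  rw [Ahat, det_smul_one_sub_sparse, a2C, a1C, a0C]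
  field_simp
  ring_nf
  simp only [Complex.I_sq]
  ring
end

section
/- Let n ∈ ℤ and β ∈ ℂ satisfy the characteristic equation β⁶ + a₂(n)β⁴ + a₁(n)β² + a₀(n) = 0, and suppose Θ := β² − (cα + n²) ≠ 0. Set Q := ωcα(bβ² − (bn² + 1))/Θ. Then the vector v = (in, β, β², β³, in·Q, in·β·Q)ᵗ ∈ ℂ⁶ satisfies Â(n)·v = β·v, i.e., v is an eigenvector of Â(n) with eigenvalue β. -/
open Matrix

/-- If `β` satisfies the characteristic equation of `Â(n)` and `Θ = β² − (cα + n²) ≠ 0`,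
then `v = (in, β, β², β³, in·Q, in·β·Q)ᵗ` with `Q = ωcα(bβ² − (bn² + 1))/Θ` is an
eigenvector of `Â(n)` with eigenvalue `β`. -/
theorem eigenvector_Ahat (a b c d ω : ℝ) (ha : 0 < a) (hb : 0 < b) (hc : 0 < c) (hd : 0 < d)
    (n : ℤ) (β : ℂ)
    (hroot : β ^ 6 + a2C a b c d ω n * β ^ 4 + a1C a b c d ω n * β ^ 2 + a0C a b c d ω n = 0)
    (hΘ : β ^ 2 - ((c : ℂ) * (1 / ((a : ℂ) * (c : ℂ))) + (n : ℂ) ^ 2) ≠ 0)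
    (Q : ℂ)
    (hQ : Q = (ω : ℂ) * c * (1 / ((a : ℂ) * (c : ℂ))) * ((b : ℂ) * β ^ 2 - ((b : ℂ) * (n : ℂ) ^ 2 + 1)) /
      (β ^ 2 - ((c : ℂ) * (1 / ((a : ℂ) * (c : ℂ))) + (n : ℂ) ^ 2))) :
    Ahat a b c d ω n *ᵥ
        ![Complex.I * (n : ℂ), β, β ^ 2, β ^ 3, Complex.I * (n : ℂ) * Q, Complex.I * (n : ℂ) * β * Q] =
      β • ![Complex.I * (n : ℂ), β, β ^ 2, β ^ 3, Complex.I * (n : ℂ) * Q, Complex.I * (n : ℂ) * β * Q] := by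
  have hc' : (c : ℂ) ≠ 0 := by exact_mod_cast hc.ne'
  have hγ : (c : ℂ) * (1 / (c : ℂ)) = 1 := by field_simp
  rw [eq_div_iff hΘ] at hQ
  simp only [a2C, a1C, a0C] at hroot
  simp only [Ahat]
  generalize (1 / ((a : ℂ) * (c : ℂ))) = α at *
  generalize (1 / (c : ℂ)) = γ at *
  generalize (n : ℂ) = N at *
  have hI : Complex.I ^ 2 = -1 := Complex.I_sq
  have hrow : β ^ 4 - β ^ 2 * (γ - N ^ 2 * (α * b * d * ω ^ 2 - 2)) - N ^ 2 * (α * d * ω ^ 2 - γ)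
      - N ^ 4 * (α * b * d * ω ^ 2 - 1) - N ^ 2 * ω * Q * (γ - α * d) = 0 := by
    refine (mul_eq_zero.mp ?_).resolve_right hΘ
    linear_combination hroot - N ^ 2 * ω * (γ - α * d) * hQ +
      α * (β ^ 2 - N ^ 2 * ω ^ 2 * b * β ^ 2 - N ^ 2 + N ^ 2 * ω ^ 2) * hγ
  ext i
  fin_cases i <;> simp [Matrix.mulVec, dotProduct, Fin.sum_univ_succ]
  · ring
  · ring
  · ring
  · linear_combination -hrow - (N ^ 2 * (α * d * ω ^ 2 - γ) + N ^ 4 * (α * b * d * ω ^ 2 - 1) +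
      N ^ 2 * ω * Q * (γ - α * d)) * hI
  · ring
  · linear_combination -Complex.I * N * hQ
end

section
/- If ω² > max{1, c/d, ac/(bd), a/b}, then for every nonzero integer n the cubic polynomial pₙ(λ) = λ³ + a₂(n)λ² + a₁(n)λ + a₀(n) has a real root λ₁(n) with λ₁(n) < 0. -/
/-- `a₂(n) = (αbdω² − 3)n² − (cα + γ)`, with `α = 1/(ac)`, `γ = 1/c`. -/
noncomputable def a2R (a b c d ω : ℝ) (n : ℤ) : ℝ :=
  let α : ℝ := 1 / (a * c)
  let γ : ℝ := 1 / c
  (α * b * d * ω ^ 2 - 3) * (n : ℝ) ^ 2 - (c * α + γ)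

/-- `a₁(n) = (3 − 2αbdω²)n⁴ + (2(cα + γ) − αω²(b + d))n² + α`, with `α = 1/(ac)`, `γ = 1/c`. -/
noncomputable def a1R (a b c d ω : ℝ) (n : ℤ) : ℝ :=
  let α : ℝ := 1 / (a * c)
  let γ : ℝ := 1 / c
  (3 - 2 * α * b * d * ω ^ 2) * (n : ℝ) ^ 4 + (2 * (c * α + γ) - α * ω ^ 2 * (b + d)) * (n : ℝ) ^ 2 + α

/-- `a₀(n) = n²[(αbdω² − 1)n⁴ + (α(dω² − c) + γ(bcαω² − 1))n² + α(ω² − 1)]`,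
with `α = 1/(ac)`, `γ = 1/c`. -/
noncomputable def a0R (a b c d ω : ℝ) (n : ℤ) : ℝ :=
  let α : ℝ := 1 / (a * c)
  let γ : ℝ := 1 / c
  (n : ℝ) ^ 2 * ((α * b * d * ω ^ 2 - 1) * (n : ℝ) ^ 4 +
    (α * (d * ω ^ 2 - c) + γ * (b * c * α * ω ^ 2 - 1)) * (n : ℝ) ^ 2 +
    α * (ω ^ 2 - 1))

/-- A monic real cubic with positive constant term has a negative root. -/
theorem exists_neg_root_of_monic_cubic (A B C : ℝ) (hC : 0 < C) :
    ∃ x : ℝ, x < 0 ∧ x ^ 3 + A * x ^ 2 + B * x + C = 0 := by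
  set M : ℝ := 1 + |A| + |B| + C with hM
  have hA := abs_nonneg A
  have hB := abs_nonneg B
  have hM1 : 1 ≤ M := by linarith
  have hle : (-M) ^ 3 + A * (-M) ^ 2 + B * (-M) + C ≤ 0 := by
    have h1 : A * M ^ 2 ≤ |A| * M ^ 2 := by gcongr; exact le_abs_self A
    have h2 : -B * M ≤ |B| * M ^ 2 := by
      calc -B * M ≤ |B| * M := by gcongr; exact neg_le_abs B
        _ ≤ |B| * M ^ 2 := by gcongr; nlinarith
    have h3 : C ≤ C * M ^ 2 := le_mul_of_one_le_right hC.le (one_le_pow₀ hM1)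
    have h4 : M ^ 3 = M ^ 2 + |A| * M ^ 2 + |B| * M ^ 2 + C * M ^ 2 := by
      rw [pow_succ]
      nth_rewrite 2 [hM]
      ring
    nlinarith [sq_nonneg M]
  have hcont : ContinuousOn (fun x : ℝ => x ^ 3 + A * x ^ 2 + B * x + C) (Set.Icc (-M) 0) := by
    fun_prop
  obtain ⟨x, hx, hx0⟩ := intermediate_value_Icc (by linarith) hcont
    (show (0 : ℝ) ∈ Set.Icc _ _ from ⟨hle, by simpa using hC.le⟩)
  refine ⟨x, lt_of_le_of_ne hx.2 ?_, hx0⟩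
  rintro rfl
  simp at hx0
  exact hC.ne' hx0

/-- If `ω² > max{1, c/d, ac/(bd), a/b}`, then for every nonzero integer `n` the cubic
`pₙ(λ) = λ³ + a₂(n)λ² + a₁(n)λ + a₀(n)` has a negative real root. -/
theorem cubic_has_negative_root (a b c d ω : ℝ) (ha : 0 < a) (hb : 0 < b) (hc : 0 < c)
    (hd : 0 < d)
    (hω : ω ^ 2 > max (max 1 (c / d)) (max (a * c / (b * d)) (a / b)))
    (n : ℤ) (hn : n ≠ 0) :
    ∃ lam : ℝ, lam < 0 ∧
      lam ^ 3 + a2R a b c d ω n * lam ^ 2 + a1R a b c d ω n * lam + a0R a b c d ω n = 0 := by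
  apply exists_neg_root_of_monic_cubic
  obtain ⟨⟨h1, h2⟩, h3, h4⟩ : (1 < ω ^ 2 ∧ c / d < ω ^ 2) ∧
      a * c / (b * d) < ω ^ 2 ∧ a / b < ω ^ 2 := by
    simpa only [gt_iff_lt, max_lt_iff] using hω
  rw [div_lt_iff₀ (by positivity)] at h2 h3 h4
  have hn2 : 0 < (n : ℝ) ^ 2 := by positivity
  have e1 : 0 < 1 / (a * c) * b * d * ω ^ 2 - 1 := by
    have : 1 / (a * c) * b * d * ω ^ 2 - 1 = (ω ^ 2 * (b * d) - a * c) / (a * c) := by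
      field_simp
    rw [this]
    exact div_pos (by linarith) (by positivity)
  have e2 : 0 < d * ω ^ 2 - c := by linarith
  have e3 : 0 < b * c * (1 / (a * c)) * ω ^ 2 - 1 := by
    have : b * c * (1 / (a * c)) * ω ^ 2 - 1 = (ω ^ 2 * b - a) / a := by
      field_simp
    rw [this]
    exact div_pos (by linarith) ha
  have e4 : 0 < ω ^ 2 - 1 := by linarith
  simp only [a0R]
  positivity
end

section
/- There exists ω₁ ≥ 0, depending only on a, b, c, d, such that whenever ω² ≥ ω₁, for every integer n one has a₂(n)² − 3a₁(n) > 0; consequently the derivative pₙ'(λ) = 3λ² + 2a₂(n)λ + a₁(n) has two distinct real roots for every n. -/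
/-- A real quadratic `3x² + 2px + q` with `p² − 3q > 0` has two distinct real roots. -/
theorem exists_ne_roots_of_reduced_discrim_pos {p q : ℝ} (h : 0 < p ^ 2 - 3 * q) :
    ∃ x y : ℝ, x ≠ y ∧ 3 * x ^ 2 + 2 * p * x + q = 0 ∧ 3 * y ^ 2 + 2 * p * y + q = 0 := by
  have hs : 0 < √(p ^ 2 - 3 * q) := Real.sqrt_pos.2 h
  have hsq : √(p ^ 2 - 3 * q) ^ 2 = p ^ 2 - 3 * q := Real.sq_sqrt h.le
  refine ⟨(-p + √(p ^ 2 - 3 * q)) / 3, (-p - √(p ^ 2 - 3 * q)) / 3, fun he => ?_, ?_, ?_⟩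
  · linarith
  · linear_combination hsq / 3
  · linear_combination hsq / 3

theorem a2R_sq_sub_three_mul_a1R (a b c d ω : ℝ) (n : ℤ) (ha : a ≠ 0) (hc : c ≠ 0) :
    a2R a b c d ω n ^ 2 - 3 * a1R a b c d ω n =
      (b * d / (a * c) * ω ^ 2 * n ^ 2) *
          (b * d / (a * c) * ω ^ 2 * n ^ 2 - 2 * (1 / a + 1 / c)) +
        3 * (b + d) / (a * c) * ω ^ 2 * n ^ 2 + ((1 / a - 1 / c) ^ 2 + 1 / (a * c)) := by
  simp only [a2R, a1R]
  field_simp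
  ring

/-- There exists `ω₁ ≥ 0`, depending only on `a, b, c, d`, such that whenever `ω² ≥ ω₁`,
for every integer `n` one has `a₂(n)² − 3a₁(n) > 0`; consequently
`pₙ'(λ) = 3λ² + 2a₂(n)λ + a₁(n)` has two distinct real roots for every `n`. -/
theorem discriminant_derivative_pos (a b c d : ℝ) (ha : 0 < a) (hb : 0 < b) (hc : 0 < c)
    (hd : 0 < d) :
    ∃ ω₁ : ℝ, 0 ≤ ω₁ ∧ ∀ ω : ℝ, ω₁ ≤ ω ^ 2 → ∀ n : ℤ,
      0 < a2R a b c d ω n ^ 2 - 3 * a1R a b c d ω n ∧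
      ∃ x y : ℝ, x ≠ y ∧
        3 * x ^ 2 + 2 * a2R a b c d ω n * x + a1R a b c d ω n = 0 ∧
        3 * y ^ 2 + 2 * a2R a b c d ω n * y + a1R a b c d ω n = 0 := by
  refine ⟨2 * (1 / a + 1 / c) / (b * d / (a * c)), by positivity, fun ω hω n => ?_⟩
  have hpos : 0 < a2R a b c d ω n ^ 2 - 3 * a1R a b c d ω n := by
    rw [a2R_sq_sub_three_mul_a1R a b c d ω n ha.ne' hc.ne']
    have hconst : 0 < (1 / a - 1 / c) ^ 2 + 1 / (a * c) := by positivity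
    obtain rfl | hn := eq_or_ne n 0
    · simpa using hconst
    have hn1 : (1 : ℝ) ≤ (n : ℝ) ^ 2 := by
      exact_mod_cast (show (1 : ℤ) ≤ n ^ 2 from Int.add_one_le_of_lt (sq_pos_of_ne_zero hn))
    have hk : 2 * (1 / a + 1 / c) ≤ b * d / (a * c) * ω ^ 2 := by
      rwa [div_le_iff₀' (by positivity)] at hω
    have hkn : b * d / (a * c) * ω ^ 2 ≤ b * d / (a * c) * ω ^ 2 * (n : ℝ) ^ 2 :=
      le_mul_of_one_le_right (by positivity) hn1
    have hprod := mul_nonneg (show 0 ≤ b * d / (a * c) * ω ^ 2 * (n : ℝ) ^ 2 by positivity)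
      (sub_nonneg.2 (hk.trans hkn))
    have hlin : 0 ≤ 3 * (b + d) / (a * c) * ω ^ 2 * (n : ℝ) ^ 2 := by positivity
    linarith
  exact ⟨hpos, exists_ne_roots_of_reduced_discrim_pos hpos⟩
end

section
/- Let p be a positive integer and let u, v : ℝ² → ℝ be smooth functions that are 2π-periodic in the first variable x. Then for every y ∈ ℝ, ∫₀^{2π} [∂_x(u·(v_x)^p) + ∂_y(u·(v_y)^p)]·v_y dx = ∫₀^{2π} [∂_y(u·(v_y)^{p+1}) − (u/(p+1))·∂_y((v_x)^{p+1} + (v_y)^{p+1})] dx, where subscripts denote partial derivatives. -/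
open Real intervalIntegral

/-- The partial derivative in `x` of a differentiable function on the plane. -/
lemma hasDerivAt_slice_fst {F : ℝ × ℝ → ℝ} (hF : Differentiable ℝ F) (x y : ℝ) :
    HasDerivAt (fun s => F (s, y)) (fderiv ℝ F (x, y) (1, 0)) x :=
  (hF (x, y)).hasFDerivAt.comp_hasDerivAt x ((hasDerivAt_id x).prodMk (hasDerivAt_const x y))

/-- The partial derivative in `y` of a differentiable function on the plane. -/
lemma hasDerivAt_slice_snd {F : ℝ × ℝ → ℝ} (hF : Differentiable ℝ F) (x y : ℝ) :
    HasDerivAt (fun s => F (x, s)) (fderiv ℝ F (x, y) (0, 1)) y :=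
  (hF (x, y)).hasFDerivAt.comp_hasDerivAt y ((hasDerivAt_const y x).prodMk (hasDerivAt_id y))

lemma contDiff_fderiv_apply_const {F : ℝ × ℝ → ℝ} (hF : ContDiff ℝ (⊤ : ℕ∞) F) (w : ℝ × ℝ) :
    ContDiff ℝ (⊤ : ℕ∞) (fun q => fderiv ℝ F q w) :=
  (hF.fderiv_right (by norm_cast)).clm_apply contDiff_const

/-- Directional derivatives of a smooth function on the plane commute. -/
lemma fderiv_fderiv_apply_comm {F : ℝ × ℝ → ℝ} (hF : ContDiff ℝ (⊤ : ℕ∞) F) (q w z : ℝ × ℝ) :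
    fderiv ℝ (fun q => fderiv ℝ F q w) q z = fderiv ℝ (fun q => fderiv ℝ F q z) q w := by
  have hd : DifferentiableAt ℝ (fderiv ℝ F) q :=
    (hF.fderiv_right (m := 1) (by norm_cast)).differentiable one_ne_zero q
  have hs : IsSymmSndFDerivAt ℝ F q :=
    hF.contDiffAt.isSymmSndFDerivAt
      (by simpa using WithTop.coe_le_coe.2 (le_top : (2 : ℕ∞) ≤ ⊤))
  rw [fderiv_clm_apply hd (differentiableAt_const w),
    fderiv_clm_apply hd (differentiableAt_const z)]
  simpa using hs.eq z w

/-- For a positive integer `p` and smooth `u, v : ℝ² → ℝ` that are `2π`-periodic in `x`,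
`∫₀^{2π} [∂_x(u (v_x)^p) + ∂_y(u (v_y)^p)] v_y dx
  = ∫₀^{2π} [∂_y(u (v_y)^{p+1}) − (u/(p+1)) ∂_y((v_x)^{p+1} + (v_y)^{p+1})] dx`. -/
theorem periodic_int_by_parts_nonlinear (p : ℕ) (hp : 0 < p) (u v : ℝ → ℝ → ℝ)
    (hu : ContDiff ℝ (⊤ : ℕ∞) (fun q : ℝ × ℝ => u q.1 q.2))
    (hv : ContDiff ℝ (⊤ : ℕ∞) (fun q : ℝ × ℝ => v q.1 q.2))
    (hup : ∀ x y : ℝ, u (x + 2 * π) y = u x y)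
    (hvp : ∀ x y : ℝ, v (x + 2 * π) y = v x y)
    (y : ℝ) :
    ∫ x in (0:ℝ)..(2 * π),
        (deriv (fun s => u s y * (deriv (fun r => v r y) s) ^ p) x +
          deriv (fun s => u x s * (deriv (fun t => v x t) s) ^ p) y) *
          deriv (fun t => v x t) y =
      ∫ x in (0:ℝ)..(2 * π),
        (deriv (fun s => u x s * (deriv (fun t => v x t) s) ^ (p + 1)) y -
          (u x y / (p + 1)) *
            deriv (fun s => (deriv (fun r => v r s) x) ^ (p + 1) +
              (deriv (fun t => v x t) s) ^ (p + 1)) y) := by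
  set U : ℝ × ℝ → ℝ := fun q => u q.1 q.2
  set V : ℝ × ℝ → ℝ := fun q => v q.1 q.2
  set a : ℝ × ℝ → ℝ := fun q => fderiv ℝ V q (1, 0)
  set b : ℝ × ℝ → ℝ := fun q => fderiv ℝ V q (0, 1)
  have hac : ContDiff ℝ (⊤ : ℕ∞) a := contDiff_fderiv_apply_const hv _
  have hbc : ContDiff ℝ (⊤ : ℕ∞) b := contDiff_fderiv_apply_const hv _
  have dU : Differentiable ℝ U := hu.differentiable (by simp)
  have dV : Differentiable ℝ V := hv.differentiable (by simp)
  have da : Differentiable ℝ a := hac.differentiable (by simp)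
  have db : Differentiable ℝ b := hbc.differentiable (by simp)
  have e1 : ∀ x y, deriv (fun r => v r y) x = a (x, y) := fun x y =>
    (hasDerivAt_slice_fst dV x y).deriv
  have e2 : ∀ x y, deriv (fun t => v x t) y = b (x, y) := fun x y =>
    (hasDerivAt_slice_snd dV x y).deriv
  have e3 : ∀ x y, u x y = U (x, y) := fun _ _ => rfl
  simp only [e1, e2, e3]
  have symm : ∀ q, fderiv ℝ a q (0, 1) = fderiv ℝ b q (1, 0) := fun q =>
    fderiv_fderiv_apply_comm hv q _ _
  have hA : ContDiff ℝ (⊤ : ℕ∞) (fun q => U q * a q ^ p) := hu.mul (hac.pow p)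
  have hB : ContDiff ℝ (⊤ : ℕ∞) (fun q => U q * b q ^ p) := hu.mul (hbc.pow p)
  have dA := hA.differentiable (by simp)
  have dB := hB.differentiable (by simp)
  have cfd : ∀ {F : ℝ × ℝ → ℝ}, ContDiff ℝ (⊤ : ℕ∞) F → ∀ w,
      Continuous (fun x : ℝ => fderiv ℝ F (x, y) w) := fun hF w =>
    (contDiff_fderiv_apply_const hF w).continuous.comp (by fun_prop)
  have csl : ∀ {F : ℝ × ℝ → ℝ}, ContDiff ℝ (⊤ : ℕ∞) F →
      Continuous (fun x : ℝ => F (x, y)) := fun hF => hF.continuous.comp (by fun_prop)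
  have l1 : ∀ x, deriv (fun s => U (s, y) * a (s, y) ^ p) x =
      fderiv ℝ (fun q => U q * a q ^ p) (x, y) (1, 0) := fun x =>
    (hasDerivAt_slice_fst dA x y).deriv
  have l2 : ∀ x, deriv (fun s => U (x, s) * b (x, s) ^ p) y =
      fderiv ℝ (fun q => U q * b q ^ p) (x, y) (0, 1) := fun x =>
    (hasDerivAt_slice_snd dB x y).deriv
  have l3 : ∀ x, deriv (fun s => U (x, s) * b (x, s) ^ (p + 1)) y =
      fderiv ℝ (fun q => U q * b q ^ p) (x, y) (0, 1) * b (x, y) +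
        U (x, y) * b (x, y) ^ p * fderiv ℝ b (x, y) (0, 1) := fun x => by
    have h := (hasDerivAt_slice_snd dB x y).fun_mul (hasDerivAt_slice_snd db x y)
    rw [← h.deriv]
    congr 1
    funext s
    ring
  have l4 : ∀ x, U (x, y) / (p + 1) * deriv (fun s => a (x, s) ^ (p + 1) + b (x, s) ^ (p + 1)) y =
      U (x, y) * a (x, y) ^ p * fderiv ℝ b (x, y) (1, 0) +
        U (x, y) * b (x, y) ^ p * fderiv ℝ b (x, y) (0, 1) := fun x => by
    have h := ((hasDerivAt_slice_snd da x y).fun_pow (p + 1)).fun_add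
      ((hasDerivAt_slice_snd db x y).fun_pow (p + 1))
    have hp1 : (p : ℝ) + 1 ≠ 0 := by positivity
    rw [h.deriv, ← symm]
    push_cast
    field_simp
  simp only [l1, l2, l3, l4]
  have hper : ∀ x, U (x + 2 * π, y) * a (x + 2 * π, y) ^ p * b (x + 2 * π, y) =
      U (x, y) * a (x, y) ^ p * b (x, y) := fun x => by
    rw [← e1, ← e1, ← e2, ← e2, ← e3, ← e3, hup, ← deriv_comp_add_const (fun r => v r y)]
    simp only [hvp]
  have hint : ∫ x in (0:ℝ)..(2 * π),
      (fderiv ℝ (fun q => U q * a q ^ p) (x, y) (1, 0) * b (x, y) +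
        U (x, y) * a (x, y) ^ p * fderiv ℝ b (x, y) (1, 0)) = 0 := by
    rw [integral_eq_sub_of_hasDerivAt (fun x _ =>
      (hasDerivAt_slice_fst dA x y).fun_mul (hasDerivAt_slice_fst db x y))
      ((((cfd hA _).mul (csl hbc)).add ((csl hA).mul (cfd hbc _))).intervalIntegrable _ _)]
    have := hper 0
    rw [zero_add] at this
    exact sub_eq_zero.2 this
  rw [← sub_eq_zero, ← integral_sub]
  · refine Eq.trans ?_ hint
    congr 1
    funext x
    ring
  · exact (((cfd hA _).add (cfd hB _)).mul (csl hbc)).intervalIntegrable _ _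
  · exact ((((cfd hB _).mul (csl hbc)).add ((csl hB).mul (cfd hbc _))).sub
      (((csl hA).mul (cfd hbc _)).add ((csl hB).mul (cfd hbc _)))).intervalIntegrable _ _
end

section
/- Fix a, b, c, d > 0 with b = d and a > d, let ω satisfy ω² ≥ max{1, c/d, ac/d², a/d}, and set α = 1/(ac). For every nonzero integer n and every real root λ < 0 of the cubic pₙ, setting Q := ωcα(bλ − (bn² + 1))/(λ − (cα + n²)), one has the inequality −n² − cn⁴ + cλ² − n²(1 + an²)Q² + 2ωn²(1 + dn²)Q ≥ 0. -/
/-- With `x = n² − λ`, clearing denominators in `pₙ(λ) = 0` for `b = d` gives a factored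
relation. -/
theorem cubic_root_factored {a c d ω lam : ℝ} (ha : 0 < a) (hc : 0 < c) (n : ℤ)
    (hroot : lam ^ 3 + a2R a d c d ω n * lam ^ 2 + a1R a d c d ω n * lam +
      a0R a d c d ω n = 0) :
    ω ^ 2 * (n : ℝ) ^ 2 * (d * ((n : ℝ) ^ 2 - lam) + 1) ^ 2 =
      ((n : ℝ) ^ 2 - lam) * (a * ((n : ℝ) ^ 2 - lam) + 1) * (c * ((n : ℝ) ^ 2 - lam) + 1) := by
  simp only [a2R, a1R, a0R] at hroot
  field_simp at hroot
  linear_combination hroot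

/-- The energy coefficient with `x = m − λ`, in terms of `A = m Q²` and `B = m ω Q`, is `x - m`
times a manifestly nonnegative factor. -/
theorem energy_coefficient_nonneg {a c d m x A B : ℝ} (hc : 0 < c) (hd : 0 < d) (had : d < a)
    (hx : 0 < x) (hmx : m < x)
    (hA : A = x * (c * x + 1) / (a * x + 1)) (hB : B = x * (c * x + 1) / (d * x + 1)) :
    0 ≤ -m - c * m ^ 2 + c * (m - x) ^ 2 - (1 + a * m) * A + 2 * (1 + d * m) * B := by
  have ha : 0 < a := hd.trans had
  have hax : 0 < a * x + 1 := by positivity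
  have hdx : 0 < d * x + 1 := by positivity
  have key : -m - c * m ^ 2 + c * (m - x) ^ 2 - (1 + a * m) * A + 2 * (1 + d * m) * B =
      (x - m) * (c * x + (c * x + 1) *
        (1 / (d * x + 1) + (1 / (d * x + 1) - 1 / (a * x + 1)))) := by
    have hax' := hax.ne'
    have hdx' := hdx.ne'
    rw [hA, hB]
    field_simp
    ring
  have hle : 1 / (a * x + 1) ≤ 1 / (d * x + 1) := by gcongr
  rw [key]
  have h1 := sub_nonneg.mpr hle
  have h2 := sub_nonneg.mpr hmx.le
  positivity

/-- For `a, b, c, d > 0` with `b = d`, `a > d`, `ω² ≥ max{1, c/d, ac/d², a/d}`, every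
nonzero integer `n` and every real root `λ < 0` of the cubic `pₙ`, with
`Q = ωcα(bλ − (bn² + 1))/(λ − (cα + n²))` (`α = 1/(ac)`), one has
`−n² − cn⁴ + cλ² − n²(1 + an²)Q² + 2ωn²(1 + dn²)Q ≥ 0`. -/
theorem Gamma1_nonneg (a b c d ω : ℝ) (ha : 0 < a) (hb : 0 < b) (hc : 0 < c) (hd : 0 < d)
    (hbd : b = d) (had : a > d)
    (hω : ω ^ 2 ≥ max (max 1 (c / d)) (max (a * c / d ^ 2) (a / d)))
    (n : ℤ) (hn : n ≠ 0) (lam : ℝ) (hlam : lam < 0)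
    (hroot : lam ^ 3 + a2R a b c d ω n * lam ^ 2 + a1R a b c d ω n * lam +
      a0R a b c d ω n = 0)
    (Q : ℝ)
    (hQ : Q = ω * c * (1 / (a * c)) * (b * lam - (b * (n : ℝ) ^ 2 + 1)) /
      (lam - (c * (1 / (a * c)) + (n : ℝ) ^ 2))) :
    0 ≤ -(n : ℝ) ^ 2 - c * (n : ℝ) ^ 4 + c * lam ^ 2 -
        (n : ℝ) ^ 2 * (1 + a * (n : ℝ) ^ 2) * Q ^ 2 +
        2 * ω * (n : ℝ) ^ 2 * (1 + d * (n : ℝ) ^ 2) * Q := by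
  subst hbd
  have hm : 0 ≤ (n : ℝ) ^ 2 := sq_nonneg _
  have hfac := cubic_root_factored ha hc n hroot
  obtain ⟨x, hx⟩ : ∃ x, x = (n : ℝ) ^ 2 - lam := ⟨_, rfl⟩
  rw [← hx] at hfac
  have hx0 : 0 < x := by linarith
  have hax : 0 < a * x + 1 := by positivity
  have hdx : 0 < b * x + 1 := by positivity
  have hQ' : Q = ω * (b * x + 1) / (a * x + 1) := by
    have hden : lam - (c * (1 / (a * c)) + (n : ℝ) ^ 2) = -((a * x + 1) / a) := by
      rw [hx]; field_simp; ring
    rw [hQ, hden]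
    field_simp
    rw [hx]; ring
  have hA : (n : ℝ) ^ 2 * Q ^ 2 = x * (c * x + 1) / (a * x + 1) := by
    rw [hQ']
    field_simp
    linear_combination hfac
  have hB : (n : ℝ) ^ 2 * (ω * Q) = x * (c * x + 1) / (b * x + 1) := by
    rw [hQ']
    field_simp
    linear_combination hfac
  have h := energy_coefficient_nonneg hc hb had hx0 (by linarith : (n : ℝ) ^ 2 < x) hA hB
  have hlam_eq : lam = (n : ℝ) ^ 2 - x := by linarith
  rw [hlam_eq]
  linear_combination h
end
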